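/- arXiv:2306.01718 — 3 statements merged into one kernel-verified Lean document; each statement's English description precedes it below -/
import Mathlib

section
/- Let F be a field, let T be an order-three tensor over F, and let i, j ∈ {1,2,3} be distinct. Then ρ_{i,j}(T) ≤ Q̲(T), where Q̲(T) denotes the border subrank of T. -/
open scoped BigOperators

namespace Paper

variable {F : Type*} [Field F]

/-- Restriction of order-three tensors: `T ≥ S` iff there exist linear maps
(given by matrices `L1, L2, L3`) carrying `T` to `S`. -/
def Restricts {ι1 ι2 ι3 κ1 κ2 κ3 : Type*} [Fintype ι1] [Fintype ι2] [Fintype ι3]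
    (T : ι1 → ι2 → ι3 → F) (S : κ1 → κ2 → κ3 → F) : Prop :=
  ∃ (L1 : κ1 → ι1 → F) (L2 : κ2 → ι2 → F) (L3 : κ3 → ι3 → F),
    ∀ a b c, S a b c = ∑ i, ∑ j, ∑ k, L1 a i * L2 b j * L3 c k * T i j k

/-- The unit (diagonal) tensor `⟨r⟩`. -/
def unitTensor (F : Type*) [Field F] (r : ℕ) : Fin r → Fin r → Fin r → F :=
  fun i j k => if i = j ∧ j = k then 1 else 0

/-- The subrank `Q(T)`: the largest `r` such that `T` restricts to `⟨r⟩`. -/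
noncomputable def subrank {ι1 ι2 ι3 : Type*} [Fintype ι1] [Fintype ι2] [Fintype ι3]
    (T : ι1 → ι2 → ι3 → F) : ℕ :=
  sSup {r : ℕ | Restricts T (unitTensor F r)}

/-- Kronecker (tensor) power `T^{⊠ m}` of an order-three tensor. -/
def kronPow {ι1 ι2 ι3 : Type*} (T : ι1 → ι2 → ι3 → F) (m : ℕ) :
    (Fin m → ι1) → (Fin m → ι2) → (Fin m → ι3) → F :=
  fun x y z => ∏ s : Fin m, T (x s) (y s) (z s)

/-- Asymptotic subrank `Q~(T) = lim_n Q(T^{⊠n})^{1/n} = sup_n Q(T^{⊠n})^{1/n}`. -/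
noncomputable def asympSubrank {ι1 ι2 ι3 : Type*} [Fintype ι1] [Fintype ι2] [Fintype ι3]
    (T : ι1 → ι2 → ι3 → F) : ℝ :=
  ⨆ m : ℕ, (subrank (kronPow T (m + 1)) : ℝ) ^ ((1 : ℝ) / (m + 1))

/-- First flattening of a tensor. -/
def flattening1 {ι1 ι2 ι3 : Type*} (T : ι1 → ι2 → ι3 → F) : Matrix ι1 (ι2 × ι3) F :=
  Matrix.of fun i p => T i p.1 p.2

/-- Second flattening of a tensor. -/
def flattening2 {ι1 ι2 ι3 : Type*} (T : ι1 → ι2 → ι3 → F) : Matrix ι2 (ι1 × ι3) F :=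
  Matrix.of fun j p => T p.1 j p.2

/-- Third flattening of a tensor. -/
def flattening3 {ι1 ι2 ι3 : Type*} (T : ι1 → ι2 → ι3 → F) : Matrix ι3 (ι1 × ι2) F :=
  Matrix.of fun k p => T p.1 p.2 k

/-- A tensor is concise if all three flattening ranks are maximal. -/
noncomputable def Concise {ι1 ι2 ι3 : Type*} [Fintype ι1] [Fintype ι2] [Fintype ι3]
    (T : ι1 → ι2 → ι3 → F) : Prop :=
  (flattening1 T).rank = Fintype.card ι1 ∧
  (flattening2 T).rank = Fintype.card ι2 ∧
  (flattening3 T).rank = Fintype.card ι3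

/-- A tensor has slice rank one if one of its flattenings has rank one. -/
noncomputable def SliceRankOne {ι1 ι2 ι3 : Type*} [Fintype ι1] [Fintype ι2] [Fintype ι3]
    (T : ι1 → ι2 → ι3 → F) : Prop :=
  (flattening1 T).rank = 1 ∨ (flattening2 T).rank = 1 ∨ (flattening3 T).rank = 1

/-- The slice rank `SR(T)`: the least `r` such that `T` is a sum of `r` slice-rank-one
tensors. -/
noncomputable def sliceRank {ι1 ι2 ι3 : Type*} [Fintype ι1] [Fintype ι2] [Fintype ι3]
    (T : ι1 → ι2 → ι3 → F) : ℕ :=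
  sInf {r : ℕ | ∃ f : Fin r → (ι1 → ι2 → ι3 → F),
    (∀ t, SliceRankOne (f t)) ∧ T = ∑ t, f t}

/-- The liminf-asymptotic slice rank. -/
noncomputable def asympSliceRankInf {ι1 ι2 ι3 : Type*} [Fintype ι1] [Fintype ι2] [Fintype ι3]
    (T : ι1 → ι2 → ι3 → F) : ℝ :=
  Filter.liminf (fun m : ℕ => (sliceRank (kronPow T m) : ℝ) ^ ((1 : ℝ) / m)) Filter.atTop

/-- The limsup-asymptotic slice rank. -/
noncomputable def asympSliceRankSup {ι1 ι2 ι3 : Type*} [Fintype ι1] [Fintype ι2] [Fintype ι3]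
    (T : ι1 → ι2 → ι3 → F) : ℝ :=
  Filter.limsup (fun m : ℕ => (sliceRank (kronPow T m) : ℝ) ^ ((1 : ℝ) / m)) Filter.atTop

/-- The max-rank of a matrix subspace. -/
noncomputable def maxrank {m n : Type*} [Fintype n] (𝒜 : Submodule F (Matrix m n F)) : ℕ :=
  sSup {r : ℕ | ∃ A ∈ 𝒜, A.rank = r}

/-- The min-rank of a matrix subspace: the least rank of a nonzero element. -/
noncomputable def minrank {m n : Type*} [Fintype n] (𝒜 : Submodule F (Matrix m n F)) : ℕ :=
  sInf {r : ℕ | ∃ A ∈ 𝒜, A ≠ 0 ∧ A.rank = r}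

section Slices

variable {n1 n2 n3 : ℕ}

/-- Span of the 3-slices, rows indexed by direction 1, columns by direction 2. -/
def span12 (T : Fin n1 → Fin n2 → Fin n3 → F) : Submodule F (Matrix (Fin n1) (Fin n2) F) :=
  Submodule.span F (Set.range fun k : Fin n3 => Matrix.of fun i j => T i j k)

/-- Span of the 3-slices, rows indexed by direction 2, columns by direction 1. -/
def span21 (T : Fin n1 → Fin n2 → Fin n3 → F) : Submodule F (Matrix (Fin n2) (Fin n1) F) :=
  Submodule.span F (Set.range fun k : Fin n3 => Matrix.of fun j i => T i j k)

/-- Span of the 2-slices, rows indexed by direction 1, columns by direction 3. -/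
def span13 (T : Fin n1 → Fin n2 → Fin n3 → F) : Submodule F (Matrix (Fin n1) (Fin n3) F) :=
  Submodule.span F (Set.range fun j : Fin n2 => Matrix.of fun i k => T i j k)

/-- Span of the 2-slices, rows indexed by direction 3, columns by direction 1. -/
def span31 (T : Fin n1 → Fin n2 → Fin n3 → F) : Submodule F (Matrix (Fin n3) (Fin n1) F) :=
  Submodule.span F (Set.range fun j : Fin n2 => Matrix.of fun k i => T i j k)

/-- Span of the 1-slices, rows indexed by direction 2, columns by direction 3. -/
def span23 (T : Fin n1 → Fin n2 → Fin n3 → F) : Submodule F (Matrix (Fin n2) (Fin n3) F) :=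
  Submodule.span F (Set.range fun i : Fin n1 => Matrix.of fun j k => T i j k)

/-- Span of the 1-slices, rows indexed by direction 3, columns by direction 2. -/
def span32 (T : Fin n1 → Fin n2 → Fin n3 → F) : Submodule F (Matrix (Fin n3) (Fin n2) F) :=
  Submodule.span F (Set.range fun i : Fin n1 => Matrix.of fun k j => T i j k)

/-- `Q_1(T)`: max-rank of the span of the 1-slices. -/
noncomputable def Q1 (T : Fin n1 → Fin n2 → Fin n3 → F) : ℕ := maxrank (span23 T)

/-- `Q_2(T)`: max-rank of the span of the 2-slices. -/
noncomputable def Q2 (T : Fin n1 → Fin n2 → Fin n3 → F) : ℕ := maxrank (span13 T)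

/-- `Q_3(T)`: max-rank of the span of the 3-slices. -/
noncomputable def Q3 (T : Fin n1 → Fin n2 → Fin n3 → F) : ℕ := maxrank (span12 T)

end Slices

/-- `p` is the pivot of the matrix `A`: the lexicographically least position of a
nonzero entry. -/
def IsPivot {n1 n2 : ℕ} (A : Matrix (Fin n1) (Fin n2) F) (p : Fin n1 × Fin n2) : Prop :=
  A p.1 p.2 ≠ 0 ∧ ∀ q : Fin n1 × Fin n2, A q.1 q.2 ≠ 0 → p.1 < q.1 ∨ (p.1 = q.1 ∧ p.2 ≤ q.2)

/-- The set of pivots of a matrix subspace (equal to the pivots of any basis with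
pairwise distinct pivots). -/
def pivotSet {n1 n2 : ℕ} (𝒜 : Submodule F (Matrix (Fin n1) (Fin n2) F)) :
    Set (Fin n1 × Fin n2) :=
  {p | ∃ A ∈ 𝒜, IsPivot A p}

/-- `ρ(𝒜)`: the least `r = |S1| + |S2|` such that the pivots of `𝒜` are covered by the
rows `S1` and columns `S2`. -/
noncomputable def rho {n1 n2 : ℕ} (𝒜 : Submodule F (Matrix (Fin n1) (Fin n2) F)) : ℕ :=
  sInf {r : ℕ | ∃ (S1 : Finset (Fin n1)) (S2 : Finset (Fin n2)),
    S1.card + S2.card = r ∧ ∀ p ∈ pivotSet 𝒜, p.1 ∈ S1 ∨ p.2 ∈ S2}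

/-- The border subrank `Q̲(T)`: the largest `r` such that, over Laurent polynomials
in `ε`, some restriction of `T` equals `⟨r⟩ + ε S_1 + ⋯ + ε^t S_t`. -/
noncomputable def borderSubrank {ι1 ι2 ι3 : Type*} [Fintype ι1] [Fintype ι2] [Fintype ι3]
    (T : ι1 → ι2 → ι3 → F) : ℕ :=
  sSup {r : ℕ |
    ∃ (A : Fin r → ι1 → LaurentPolynomial F) (B : Fin r → ι2 → LaurentPolynomial F)
      (C : Fin r → ι3 → LaurentPolynomial F) (t : ℕ)
      (S : Fin t → (Fin r → Fin r → Fin r → F)),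
      ∀ a b c,
        (∑ i, ∑ j, ∑ k, A a i * B b j * C c k * LaurentPolynomial.C (T i j k)) =
          LaurentPolynomial.C (unitTensor F r a b c) +
            ∑ s : Fin t, LaurentPolynomial.T (((s : ℕ) : ℤ) + 1) *
              LaurentPolynomial.C (S s a b c)}

/-- The linear map `A ↦ U * A * V` on rectangular matrices. -/
def conjMap {n1 n2 : ℕ} (U : Matrix (Fin n1) (Fin n1) F) (V : Matrix (Fin n2) (Fin n2) F) :
    Matrix (Fin n1) (Fin n2) F →ₗ[F] Matrix (Fin n1) (Fin n2) F where
  toFun A := U * A * V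
  map_add' A B := by simp [Matrix.mul_add, Matrix.add_mul]
  map_smul' c A := by simp [Matrix.mul_smul, Matrix.smul_mul]

/-- The principal submatrix `A_{J×J}`, where `J ⊆ [min{n1,n2}]` is encoded by the
map `η`. -/
def restrictJJ {n1 n2 jn : ℕ} (η : Fin jn → Fin (min n1 n2))
    (A : Matrix (Fin n1) (Fin n2) F) : Matrix (Fin jn) (Fin jn) F :=
  Matrix.of fun p q =>
    A (Fin.castLE (min_le_left n1 n2) (η p)) (Fin.castLE (min_le_right n1 n2) (η q))

/-- An order-three tensor over `F` of arbitrary format. -/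
structure Tensor3 (F : Type*) [Field F] where
  n1 : ℕ
  n2 : ℕ
  n3 : ℕ
  coef : Fin n1 → Fin n2 → Fin n3 → F

/-- Two tensors are equivalent if each restricts to the other. -/
def Tensor3.Equivalent (T S : Tensor3 F) : Prop :=
  Restricts T.coef S.coef ∧ Restricts S.coef T.coef

/-- A rank-one order-`k` tensor: a tensor product of `k` nonzero vectors. -/
def RankOne {k : ℕ} {ι : Fin k → Type*} (T : ((i : Fin k) → ι i) → F) : Prop :=
  ∃ u : (i : Fin k) → (ι i → F), (∀ i, u i ≠ 0) ∧ ∀ v, T v = ∏ i, u i (v i)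

/-- The tensor rank of an order-`k` tensor. -/
noncomputable def tensorRank {k : ℕ} {ι : Fin k → Type*} (T : ((i : Fin k) → ι i) → F) : ℕ :=
  sInf {r : ℕ | ∃ f : Fin r → (((i : Fin k) → ι i) → F),
    (∀ t, RankOne (f t)) ∧ T = ∑ t, f t}

/-- Kronecker power of an order-`k` tensor. -/
def kronPowK {k : ℕ} {ι : Fin k → Type*} (T : ((i : Fin k) → ι i) → F) (m : ℕ) :
    ((i : Fin k) → (Fin m → ι i)) → F :=
  fun v => ∏ s : Fin m, T fun i => v i s

/-- The asymptotic rank `R~(T) = lim_n R(T^{⊠n})^{1/n} = inf_n R(T^{⊠n})^{1/n}`. -/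
noncomputable def asympRank {k : ℕ} {ι : Fin k → Type*} (T : ((i : Fin k) → ι i) → F) : ℝ :=
  ⨅ m : ℕ, (tensorRank (kronPowK T (m + 1)) : ℝ) ^ ((1 : ℝ) / (m + 1))

/-- The inequality half of König's theorem: if every cover of a bipartite relation by rows and
columns has at least `r` elements, then the relation contains a matching of size `r`. -/
theorem exists_matching_of_forall_cover {α β : Type*} [Fintype α] [Fintype β]
    (R : α → β → Prop) (r : ℕ)
    (h : ∀ (S₁ : Finset α) (S₂ : Finset β), (∀ a b, R a b → a ∈ S₁ ∨ b ∈ S₂) →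
      r ≤ S₁.card + S₂.card) :
    ∃ (x : Fin r → α) (y : Fin r → β), Function.Injective x ∧ Function.Injective y ∧
      ∀ l, R (x l) (y l) := by
  classical
  have hr : r ≤ Fintype.card α := by
    simpa using h Finset.univ ∅ (by simp)
  let d := Fintype.card α - r
  let t : α → Finset (β ⊕ Fin d) := fun a => (Finset.univ.filter (R a)).disjSum Finset.univ
  have hall : ∀ s : Finset α, s.card ≤ (s.biUnion t).card := by
    intro s
    rcases s.eq_empty_or_nonempty with rfl | ⟨a₀, ha₀⟩
    · simp
    have ht : s.biUnion t
        = (s.biUnion fun a => Finset.univ.filter (R a)).disjSum (Finset.univ : Finset (Fin d)) := by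
      ext (b | e)
      · simp [t]
      · simpa [t] using ⟨a₀, ha₀⟩
    have hc := h sᶜ (s.biUnion fun a => Finset.univ.filter (R a)) (by
      intro a b hab
      by_cases ha : a ∈ s
      · exact Or.inr (by simpa using ⟨a, ha, hab⟩)
      · exact Or.inl (by simpa using ha))
    rw [Finset.card_compl] at hc
    have hs := s.card_le_univ
    rw [ht, Finset.card_disjSum, Finset.card_univ, Fintype.card_fin]
    omega
  obtain ⟨f, hf, hft⟩ := (Finset.all_card_le_biUnion_card_iff_exists_injective t).1 hall
  have hcard : r ≤ Fintype.card {a // ∃ b, f a = Sum.inl b} := by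
    have hcompl : Fintype.card {a // ¬ ∃ b, f a = Sum.inl b} ≤ d := by
      have hR : ∀ a : {a // ¬ ∃ b, f a = Sum.inl b}, ∃ e : Fin d, f a = Sum.inr e := by
        rintro ⟨a, ha⟩
        rcases hfa : f a with b | e
        · exact absurd ⟨b, hfa⟩ ha
        · exact ⟨e, rfl⟩
      choose g hg using hR
      have hinj : Function.Injective g := fun a a' haa =>
        Subtype.ext (hf (by rw [hg, hg, haa]))
      simpa using Fintype.card_le_of_injective g hinj
    rw [Fintype.card_subtype_compl] at hcompl
    omega
  obtain ⟨x⟩ : Nonempty (Fin r ↪ {a // ∃ b, f a = Sum.inl b}) :=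
    Function.Embedding.nonempty_of_card_le (by simpa using hcard)
  choose y hy using fun l => (x l).2
  refine ⟨fun l => x l, y, fun l l' hl => x.injective (Subtype.ext hl), fun l l' hl => ?_,
    fun l => ?_⟩
  · exact x.injective (Subtype.ext (hf (by rw [hy, hy, hl])))
  · have hmem := hft (x l)
    rw [hy] at hmem
    simpa [t] using hmem

/-- `T` degenerates to the unit tensor `⟨r⟩`. -/
def DegeneratesToUnit {ι1 ι2 ι3 : Type*} [Fintype ι1] [Fintype ι2] [Fintype ι3]
    (T : ι1 → ι2 → ι3 → F) (r : ℕ) : Prop :=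
  ∃ (A : Fin r → ι1 → LaurentPolynomial F) (B : Fin r → ι2 → LaurentPolynomial F)
    (C : Fin r → ι3 → LaurentPolynomial F) (t : ℕ)
    (S : Fin t → (Fin r → Fin r → Fin r → F)),
    ∀ a b c,
      (∑ i, ∑ j, ∑ k, A a i * B b j * C c k * LaurentPolynomial.C (T i j k)) =
        LaurentPolynomial.C (unitTensor F r a b c) +
          ∑ s : Fin t, LaurentPolynomial.T (((s : ℕ) : ℤ) + 1) *
            LaurentPolynomial.C (S s a b c)

section Degeneration

variable {ι1 ι2 ι3 : Type*} [Fintype ι1] [Fintype ι2] [Fintype ι3] {T : ι1 → ι2 → ι3 → F} {r : ℕ}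

theorem DegeneratesToUnit.swap12 (h : DegeneratesToUnit T r) :
    DegeneratesToUnit (fun j i k => T i j k) r := by
  obtain ⟨A, B, C, t, S, h⟩ := h
  refine ⟨B, A, C, t, fun s a b c => S s b a c, fun a b c => ?_⟩
  have hu : unitTensor F r a b c = unitTensor F r b a c := by
    simp only [unitTensor]; grind
  rw [hu, ← h b a c, Finset.sum_comm]
  simp only [mul_comm (B a _)]

theorem DegeneratesToUnit.swap23 (h : DegeneratesToUnit T r) :
    DegeneratesToUnit (fun i k j => T i j k) r := by
  obtain ⟨A, B, C, t, S, h⟩ := h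
  refine ⟨A, C, B, t, fun s a b c => S s a c b, fun a b c => ?_⟩
  have hu : unitTensor F r a b c = unitTensor F r a c b := by
    simp only [unitTensor]; grind
  rw [hu, ← h a c b]
  refine Finset.sum_congr rfl fun i _ => ?_
  rw [Finset.sum_comm]
  simp only [mul_right_comm (A a i) (C b _)]

/-- A tensor with first dimension `n` degenerates to `⟨r⟩` only for `r ≤ n`. -/
theorem DegeneratesToUnit.le_card (h : DegeneratesToUnit T r) : r ≤ Fintype.card ι1 := by
  classical
  obtain ⟨A, B, C, t, S, h⟩ := h
  let P : Matrix (Fin r) (Fin r) (Polynomial F) := Matrix.of fun a b =>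
    Polynomial.C (unitTensor F r a b b) +
      ∑ s : Fin t, Polynomial.X ^ ((s : ℕ) + 1) * Polynomial.C (S s a b b)
  let N : Matrix ι1 (Fin r) (LaurentPolynomial F) := Matrix.of fun i b =>
    ∑ j, ∑ k, B b j * C b k * LaurentPolynomial.C (T i j k)
  have hP : P.det ≠ 0 := by
    intro h0
    have h1 : (P.map (Polynomial.evalRingHom (0 : F))) = 1 := by
      ext a b
      by_cases hab : a = b <;>
        simp [P, Matrix.one_apply, unitTensor, Polynomial.eval_finsetSum, hab]
    have h2 := RingHom.map_det (Polynomial.evalRingHom (0 : F)) P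
    rw [h0, RingHom.mapMatrix_apply, h1, Matrix.det_one, map_zero] at h2
    exact zero_ne_one h2
  have hAN : Matrix.of A * N = P.map Polynomial.toLaurent := by
    ext1 a b
    have hab := h a b b
    simp only [Matrix.mul_apply, N, Matrix.of_apply, Matrix.map_apply, P, map_add, map_sum,
      map_mul, Polynomial.toLaurent_C, Polynomial.toLaurent_X_pow, Finset.mul_sum]
    simp only [mul_assoc] at hab ⊢
    exact_mod_cast hab
  have hdet : (Matrix.of A * N).det ≠ 0 := by
    rw [hAN, ← RingHom.mapMatrix_apply, ← RingHom.map_det]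
    exact Polynomial.toLaurent_ne_zero.2 hP
  have hker : LinearMap.ker N.mulVecLin = ⊥ := by
    rw [LinearMap.ker_eq_bot']
    intro v hv
    by_contra hv0
    refine hdet (Matrix.exists_mulVec_eq_zero_iff.1 ⟨v, hv0, ?_⟩)
    rw [← Matrix.mulVec_mulVec]
    rw [Matrix.mulVecLin_apply] at hv
    rw [hv, Matrix.mulVec_zero]
  simpa using LinearMap.finrank_le_finrank_of_injective (LinearMap.ker_eq_bot.1 hker)

theorem DegeneratesToUnit.le_borderSubrank (h : DegeneratesToUnit T r) : r ≤ borderSubrank T :=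
  le_csSup ⟨Fintype.card ι1, fun _ hs => DegeneratesToUnit.le_card hs⟩ h

end Degeneration

/-- A matrix space spanned by slices with `ρ = r` yields a degeneration to `⟨r⟩`: scaling row `i`
by `ε ^ (n2 * i)` and column `j` by `ε ^ j` makes the pivots of matched matrices dominate. -/
theorem degeneratesToUnit_rho_span12 {n1 n2 n3 : ℕ} (T : Fin n1 → Fin n2 → Fin n3 → F) :
    DegeneratesToUnit T (rho (span12 T)) := by
  classical
  obtain ⟨x, y, hx, hy, hxy⟩ := exists_matching_of_forall_cover
    (fun a b => (a, b) ∈ pivotSet (span12 T)) (rho (span12 T))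
    fun S₁ S₂ hS => Nat.sInf_le ⟨S₁, S₂, rfl, fun p hp => hS p.1 p.2 hp⟩
  choose M hM hpiv using hxy
  have hcoef : ∀ l, ∃ u : Fin n3 → F, ∀ i j, ∑ k, u k * T i j k = M l i j := by
    intro l
    obtain ⟨u, hu⟩ := (Submodule.mem_span_range_iff_exists_fun F).1 (hM l)
    refine ⟨u, fun i j => ?_⟩
    rw [← hu, Matrix.sum_apply]
    simp
  choose u hu using hcoef
  let w : Fin n1 → Fin n2 → ℤ := fun i j => n2 * (i : ℤ) + j
  let D : Fin (rho (span12 T)) → Fin (rho (span12 T)) → Fin (rho (span12 T)) → F :=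
    fun a b c => (M c (x c) (y c))⁻¹ * M c (x a) (y b)
  let e : Fin (rho (span12 T)) → Fin (rho (span12 T)) → Fin (rho (span12 T)) → ℤ :=
    fun a b c => w (x a) (y b) - w (x c) (y c)
  refine ⟨fun a i => if i = x a then LaurentPolynomial.T (n2 * (i : ℤ)) else 0,
    fun b j => if j = y b then LaurentPolynomial.T (j : ℤ) else 0,
    fun c k => LaurentPolynomial.C ((M c (x c) (y c))⁻¹ * u c k) *
      LaurentPolynomial.T (-w (x c) (y c)),
    n1 * n2, fun s a b c => if e a b c = (s : ℕ) + 1 then D a b c else 0, fun a b c => ?_⟩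
  have hlhs : (∑ i, ∑ j, ∑ k,
      (if i = x a then LaurentPolynomial.T (n2 * (i : ℤ)) else 0) *
        (if j = y b then LaurentPolynomial.T (j : ℤ) else 0) *
        (LaurentPolynomial.C ((M c (x c) (y c))⁻¹ * u c k) *
          LaurentPolynomial.T (-w (x c) (y c))) * LaurentPolynomial.C (T i j k))
      = LaurentPolynomial.T (e a b c) * LaurentPolynomial.C (D a b c) := by
    rw [Finset.sum_eq_single (x a) (fun i _ hi => by
        simp only [if_neg hi, zero_mul, Finset.sum_const_zero])
        (fun h => absurd (Finset.mem_univ _) h),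
      Finset.sum_eq_single (y b) (fun j _ hj => by
        simp only [if_neg hj, zero_mul, mul_zero, Finset.sum_const_zero])
        (fun h => absurd (Finset.mem_univ _) h)]
    simp only [if_true, D, ← hu, e, w, sub_eq_add_neg, LaurentPolynomial.T_add, Finset.mul_sum,
      map_sum, map_mul]
    exact Finset.sum_congr rfl fun k _ => by ring
  rw [hlhs]
  by_cases habc : a = c ∧ b = c
  · obtain ⟨rfl, rfl⟩ := habc
    have he : e b b b = 0 := sub_self _
    have hD : D b b b = 1 := inv_mul_cancel₀ (hpiv b).1
    have hs : ∀ s : Fin (n1 * n2), ¬ (0 : ℤ) = (s : ℕ) + 1 := fun s => by omega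
    simp [he, hD, unitTensor, hs]
  have hunit : unitTensor F (rho (span12 T)) a b c = 0 := if_neg (by grind)
  rw [hunit, map_zero, zero_add]
  by_cases hMz : M c (x a) (y b) = 0
  · simp [D, hMz]
  have hpos : 1 ≤ e a b c ∧ e a b c ≤ (n1 * n2 : ℕ) := by
    have hyb := (y b).2
    have hyc := (y c).2
    have hxa := (x a).2
    have hmul : (n2 : ℤ) * ((x a : ℕ) + 1) ≤ n2 * n1 :=
      mul_le_mul_of_nonneg_left (by omega) (by omega)
    have hnn : (0 : ℤ) ≤ n2 * (x c : ℕ) := by positivity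
    constructor
    · rcases (hpiv c).2 (x a, y b) hMz with hlt | ⟨heq, hle⟩
      · have hlt' : (n2 : ℤ) * ((x c : ℕ) + 1) ≤ n2 * (x a : ℕ) :=
          mul_le_mul_of_nonneg_left (by simp only [Fin.lt_def] at hlt; omega) (by omega)
        simp only [e, w]
        linarith [(by omega : ((y c : ℕ) : ℤ) + 1 ≤ n2)]
      · have hac : c = a := hx heq
        have hne : y c ≠ y b := fun hyy => habc ⟨hac.symm, (hy hyy).symm⟩
        have hlt : y c < y b := lt_of_le_of_ne hle hne
        simp only [Fin.lt_def] at hlt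
        simp only [e, w, hac]
        rw [hac] at hlt
        omega
    · simp only [e, w]
      push_cast
      linarith [(by omega : ((y b : ℕ) : ℤ) + 1 ≤ n2)]
  let s₀ : Fin (n1 * n2) := ⟨(e a b c - 1).toNat, by omega⟩
  have hs₀ : e a b c = (s₀ : ℕ) + 1 := by simp only [s₀]; omega
  rw [Finset.sum_eq_single s₀ _ (fun h => absurd (Finset.mem_univ _) h)]
  · simp only [← hs₀, if_true]
  intro s _ hs
  have hes : e a b c ≠ (s : ℕ) + 1 := fun h => hs (Fin.ext (by omega))
  simp only [if_neg hes, map_zero, mul_zero]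

/-- For any order-three tensor `T` and distinct `i, j ∈ {1,2,3}`,
`ρ_{i,j}(T)` is at most the border subrank `Q̲(T)`. -/
theorem rho_le_borderSubrank (F : Type*) [Field F] (n1 n2 n3 : ℕ)
    (T : Fin n1 → Fin n2 → Fin n3 → F)
    (i j : Fin 3) (hij : i ≠ j) :
    ![![0, rho (span12 T), rho (span13 T)],
      ![rho (span21 T), 0, rho (span23 T)],
      ![rho (span31 T), rho (span32 T), 0]] i j ≤ borderSubrank T := by
  fin_cases i <;> fin_cases j
  · exact absurd rfl hij
  · exact (degeneratesToUnit_rho_span12 T).le_borderSubrank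
  · exact (degeneratesToUnit_rho_span12 fun i k j => T i j k).swap23.le_borderSubrank
  · exact (degeneratesToUnit_rho_span12 fun j i k => T i j k).swap12.le_borderSubrank
  · exact absurd rfl hij
  · exact (degeneratesToUnit_rho_span12 fun j k i => T i j k).swap23.swap12.le_borderSubrank
  · exact (degeneratesToUnit_rho_span12 fun k i j => T i j k).swap12.swap23.le_borderSubrank
  · exact (degeneratesToUnit_rho_span12
      fun k j i => T i j k).swap12.swap23.swap12.le_borderSubrank
  · exact absurd rfl hij

end Paper
end

section
/- Let F be a field and let T be an order-three tensor over F. Suppose |F| > Q̲(T) + 1, where Q̲(T) is the border subrank of T. Then for every i ∈ {1,2,3} it holds that Q̲(T) ≤ Q_i(T). -/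
open scoped BigOperators

namespace Paper

variable {F : Type*} [Field F]

section BorderSubrankBound

open scoped Matrix

/-- A matrix over a field factors through a space of dimension its rank. -/
theorem exists_rank_factorization {m n : Type*} [Fintype n] (A : Matrix m n F) :
    ∃ (P : Matrix m (Fin A.rank) F) (Q : Matrix (Fin A.rank) n F), A = P * Q := by
  classical
  let b : Module.Basis (Fin A.rank) F (LinearMap.range A.mulVecLin) := Module.finBasis F _
  let y : n → LinearMap.range A.mulVecLin := fun j => ⟨A.col j, Pi.single j 1, by simp⟩
  refine ⟨Matrix.of fun i t => (b t : m → F) i, Matrix.of fun t j => b.repr (y j) t, ?_⟩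
  ext i j
  have h := congrArg (fun w : LinearMap.range A.mulVecLin => (w : m → F) i) (b.sum_repr (y j))
  simp only [Submodule.coe_sum, Submodule.coe_smul, Finset.sum_apply, Pi.smul_apply, smul_eq_mul,
    y, Matrix.col_apply] at h
  rw [← h, Matrix.mul_apply]
  exact Finset.sum_congr rfl fun t _ => mul_comm (b.repr (y j) t) ((b t : m → F) i)

/-- Mapping a matrix over a field into another commutative ring does not increase its rank. -/
theorem rank_map_le {m n R : Type*} [Fintype m] [Fintype n] [CommRing R] [Nontrivial R]
    (f : F →+* R) (A : Matrix m n F) : (A.map f).rank ≤ A.rank := by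
  obtain ⟨P, Q, h⟩ := exists_rank_factorization A
  calc (A.map f).rank = (P.map f * Q.map f).rank := by rw [← Matrix.map_mul, ← h]
    _ ≤ (P.map f).rank := Matrix.rank_mul_le_left _ _
    _ ≤ A.rank := (Matrix.rank_le_card_width _).trans_eq (Fintype.card_fin _)

/-- If some linear combination of `r × r` matrices over a domain is nonsingular, then one with
coefficients in any given set of more than `r` elements is. -/
theorem exists_det_sum_smul_ne_zero {κ R : Type*} [Fintype κ] [CommRing R] [IsDomain R] {r : ℕ}
    (D : κ → Matrix (Fin r) (Fin r) R) (v : κ → R) (hv : (∑ k, v k • D k).det ≠ 0)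
    (s : Finset R) (hs : r < s.card) :
    ∃ x : κ → R, (∀ k, x k ∈ s) ∧ (∑ k, x k • D k).det ≠ 0 := by
  let G : Matrix (Fin r) (Fin r) (MvPolynomial κ R) :=
    Matrix.of fun a b => ∑ k, MvPolynomial.X k * MvPolynomial.C (D k a b)
  have heval : ∀ x : κ → R, MvPolynomial.eval x G.det = (∑ k, x k • D k).det := by
    intro x
    rw [RingHom.map_det]
    congr 1
    ext a b
    simp [G, Matrix.sum_apply]
  have hentry : ∀ a b, (G a b).totalDegree ≤ 1 := by
    intro a b
    refine MvPolynomial.totalDegree_finsetSum_le fun k _ => ?_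
    refine (MvPolynomial.totalDegree_mul _ _).trans ?_
    simp
  have hdeg : G.det.totalDegree ≤ r := by
    rw [Matrix.det_apply]
    refine MvPolynomial.totalDegree_finsetSum_le fun σ _ => ?_
    refine (MvPolynomial.totalDegree_smul_le _ _).trans ?_
    refine (MvPolynomial.totalDegree_finsetProd _ _).trans ?_
    refine (Finset.sum_le_sum fun a _ => hentry (σ a) a).trans ?_
    simp
  by_contra! hx
  have hzero : G.det = 0 :=
    MvPolynomial.eq_zero_of_eval_zero_at_prod_finset _ (fun _ => s)
      (fun k => ((MvPolynomial.degreeOf_le_totalDegree _ k).trans hdeg).trans_lt hs)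
      (fun x hxs => (heval x).trans (hx x hxs))
  exact hv (by rw [← heval v, hzero, map_zero])

/-- If a linear combination of matrices over a field `F` becomes nonsingular of size `r` after
extending scalars to a domain and multiplying on both sides, then some linear combination over `F`
has rank at least `r`. -/
theorem exists_le_rank_of_det_ne_zero {κ R : Type*} [Fintype κ] [CommRing R] [IsDomain R]
    (f : F →+* R) {r m n : ℕ} (M : κ → Matrix (Fin m) (Fin n) F) (A : Matrix (Fin r) (Fin m) R)
    (B : Matrix (Fin n) (Fin r) R) (v : κ → R)
    (hv : (A * (∑ k, v k • (M k).map f) * B).det ≠ 0) (s : Finset F) (hs : r < s.card) :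
    ∃ x : κ → F, r ≤ (∑ k, x k • M k).rank := by
  classical
  have hsum : ∀ w : κ → R, A * (∑ k, w k • (M k).map f) * B =
      ∑ k, w k • (A * (M k).map f * B) := by
    intro w
    simp [Matrix.mul_sum, Matrix.sum_mul]
  rw [hsum] at hv
  obtain ⟨x, hxs, hx⟩ := exists_det_sum_smul_ne_zero _ v hv (s.image f)
    (by rwa [Finset.card_image_of_injective _ f.injective])
  have hpre : ∀ k, ∃ y, f y = x k := fun k => by
    obtain ⟨y, -, hy⟩ := Finset.mem_image.1 (hxs k)
    exact ⟨y, hy⟩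
  choose y hy using hpre
  refine ⟨y, ?_⟩
  have hmap : (∑ k, y k • M k).map f = ∑ k, x k • (M k).map f := by
    ext i j
    simp [Matrix.sum_apply, hy]
  rw [← hsum, ← hmap] at hx
  calc r = (A * (∑ k, y k • M k).map f * B).rank := by
        rw [Matrix.rank_of_det_ne_zero hx, Fintype.card_fin]
    _ ≤ (A * (∑ k, y k • M k).map f).rank := Matrix.rank_mul_le_left _ _
    _ ≤ ((∑ k, y k • M k).map f).rank := Matrix.rank_mul_le_right _ _
    _ ≤ (∑ k, y k • M k).rank := rank_map_le f _

/-- A matrix of Laurent polynomials congruent to the identity modulo `ε` is nonsingular. -/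
theorem det_ne_zero_of_eq_one_add {r t : ℕ} (N : Matrix (Fin r) (Fin r) (LaurentPolynomial F))
    (S : Fin t → Fin r → Fin r → F)
    (hN : ∀ a b, N a b = LaurentPolynomial.C (if a = b then 1 else 0) +
      ∑ s : Fin t, LaurentPolynomial.T (((s : ℕ) : ℤ) + 1) * LaurentPolynomial.C (S s a b)) :
    N.det ≠ 0 := by
  let P : Matrix (Fin r) (Fin r) (Polynomial F) := Matrix.of fun a b =>
    Polynomial.C (if a = b then 1 else 0) +
      ∑ s : Fin t, Polynomial.X ^ ((s : ℕ) + 1) * Polynomial.C (S s a b)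
  have hP : N = (Polynomial.toLaurent (R := F)).mapMatrix P := by
    ext1 a b
    rw [hN]
    simp only [P, RingHom.mapMatrix_apply, Matrix.map_apply, Matrix.of_apply, map_add, map_sum,
      map_mul, Polynomial.toLaurent_C, Polynomial.toLaurent_X_pow, Nat.cast_add, Nat.cast_one]
  have hP0 : (Polynomial.evalRingHom (0 : F)).mapMatrix P = 1 := by
    ext a b
    simp [P, Polynomial.eval_finsetSum, Matrix.one_apply, apply_ite (Polynomial.eval (0 : F))]
  rw [hP, ← RingHom.map_det, Polynomial.toLaurent_ne_zero]
  intro h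
  have h1 := congrArg (Polynomial.evalRingHom (0 : F)) h
  rw [RingHom.map_det, hP0, Matrix.det_one, map_zero] at h1
  exact one_ne_zero h1

/-- If the tensor with slices `M k` degenerates to the unit tensor `⟨r⟩` over a field with more
than `r` elements, then some linear combination of the slices has rank at least `r`. -/
theorem exists_le_rank_of_degeneration {r l m n t : ℕ} (M : Fin l → Matrix (Fin m) (Fin n) F)
    (A : Fin r → Fin m → LaurentPolynomial F) (B : Fin r → Fin n → LaurentPolynomial F)
    (C : Fin r → Fin l → LaurentPolynomial F) (S : Fin t → Fin r → Fin r → Fin r → F)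
    (h : ∀ a b c, (∑ i, ∑ j, ∑ k, A a i * B b j * C c k * LaurentPolynomial.C (M k i j)) =
      LaurentPolynomial.C (unitTensor F r a b c) +
        ∑ s : Fin t, LaurentPolynomial.T (((s : ℕ) : ℤ) + 1) *
          LaurentPolynomial.C (S s a b c))
    (s : Finset F) (hs : r < s.card) :
    ∃ x : Fin l → F, r ≤ (∑ k, x k • M k).rank := by
  refine exists_le_rank_of_det_ne_zero (LaurentPolynomial.C (R := F)) M (Matrix.of A)
    (Matrix.of B)ᵀ (fun k => ∑ c, C c k) ?_ s hs
  refine det_ne_zero_of_eq_one_add _ (fun s a b => ∑ c, S s a b c) fun a b => ?_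
  have hunit : (if a = b then (1 : F) else 0) = ∑ c, unitTensor F r a b c := by
    by_cases hab : a = b <;> simp [unitTensor, hab]
  calc _ = ∑ c, ∑ i, ∑ j, ∑ k, A a i * B b j * C c k * LaurentPolynomial.C (M k i j) := by
        simp only [Matrix.mul_apply, Matrix.sum_apply, Matrix.smul_apply, Matrix.map_apply,
          Matrix.of_apply, Matrix.transpose_apply, smul_eq_mul, Finset.sum_mul, Finset.mul_sum]
        rw [Finset.sum_comm]
        refine Eq.trans ?_ Finset.sum_comm
        refine Finset.sum_congr rfl fun i _ => ?_
        rw [Finset.sum_comm (γ := Fin r), Finset.sum_congr rfl]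
        refine fun j _ => Finset.sum_comm.trans ?_
        refine Finset.sum_congr rfl fun c _ => Finset.sum_congr rfl fun k _ => ?_
        ring
    _ = _ := by
        simp_rw [h, Finset.sum_add_distrib, hunit, map_sum, Finset.mul_sum]
        congr 1
        exact Finset.sum_comm

/-- A nonzero border subrank is attained by a degeneration. -/
theorem borderSubrank_eq_zero_or_exists_degeneration {ι1 ι2 ι3 : Type*} [Fintype ι1] [Fintype ι2]
    [Fintype ι3] (T : ι1 → ι2 → ι3 → F) :
    borderSubrank T = 0 ∨ ∃ (A : Fin (borderSubrank T) → ι1 → LaurentPolynomial F)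
      (B : Fin (borderSubrank T) → ι2 → LaurentPolynomial F)
      (C : Fin (borderSubrank T) → ι3 → LaurentPolynomial F) (t : ℕ)
      (S : Fin t → Fin (borderSubrank T) → Fin (borderSubrank T) → Fin (borderSubrank T) → F),
      ∀ a b c, (∑ i, ∑ j, ∑ k, A a i * B b j * C c k * LaurentPolynomial.C (T i j k)) =
        LaurentPolynomial.C (unitTensor F (borderSubrank T) a b c) +
          ∑ s : Fin t, LaurentPolynomial.T (((s : ℕ) : ℤ) + 1) *
            LaurentPolynomial.C (S s a b c) := by
  have key : ∀ U : Set ℕ, sSup U = 0 ∨ sSup U ∈ U := by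
    intro U
    by_cases hb : BddAbove U
    · rcases U.eq_empty_or_nonempty with rfl | hne
      · exact .inl (by simp)
      · exact .inr (Nat.sSup_mem hne hb)
    · exact .inl (Nat.sSup_of_not_bddAbove hb)
  exact key _

/-- The rank of an element of a matrix subspace is at most the max-rank. -/
theorem rank_le_maxrank {m n : Type*} [Fintype n] (𝒜 : Submodule F (Matrix m n F))
    {A : Matrix m n F} (hA : A ∈ 𝒜) : A.rank ≤ maxrank 𝒜 :=
  le_csSup ⟨Fintype.card n, by rintro _ ⟨B, -, rfl⟩; exact B.rank_le_card_width⟩ ⟨A, hA, rfl⟩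

/-- The max-rank of a span of slices of a tensor degenerating to `⟨r⟩` is at least `r`. -/
theorem le_maxrank_of_degeneration {r l m n t : ℕ} (M : Fin l → Matrix (Fin m) (Fin n) F)
    (A : Fin r → Fin m → LaurentPolynomial F) (B : Fin r → Fin n → LaurentPolynomial F)
    (C : Fin r → Fin l → LaurentPolynomial F) (S : Fin t → Fin r → Fin r → Fin r → F)
    (h : ∀ a b c, (∑ i, ∑ j, ∑ k, A a i * B b j * C c k * LaurentPolynomial.C (M k i j)) =
      LaurentPolynomial.C (unitTensor F r a b c) +
        ∑ s : Fin t, LaurentPolynomial.T (((s : ℕ) : ℤ) + 1) *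
          LaurentPolynomial.C (S s a b c))
    (s : Finset F) (hs : r < s.card) :
    r ≤ maxrank (Submodule.span F (Set.range M)) := by
  obtain ⟨x, hx⟩ := exists_le_rank_of_degeneration M A B C S h s hs
  refine hx.trans (rank_le_maxrank _ ?_)
  exact Submodule.sum_mem _ fun k _ =>
    Submodule.smul_mem _ _ (Submodule.subset_span (Set.mem_range_self k))

end BorderSubrankBound

/-- If `|F| > Q̲(T) + 1`, then the border subrank is at most each
max-rank `Q_i(T)`, `i ∈ {1,2,3}`. -/
theorem borderSubrank_le_maxrank (F : Type*) [Field F] (n1 n2 n3 : ℕ)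
    (T : Fin n1 → Fin n2 → Fin n3 → F)
    (hF : ((borderSubrank T : ℕ) : Cardinal) + 1 < Cardinal.mk F) :
    ∀ i : Fin 3, borderSubrank T ≤ ![Q1 T, Q2 T, Q3 T] i := by
  obtain ⟨s, hs⟩ := Cardinal.exists_finset_le_card F (borderSubrank T + 1)
    (by exact_mod_cast hF.le)
  rcases borderSubrank_eq_zero_or_exists_degeneration T with h0 | ⟨A, B, C, t, S, h⟩
  · intro i
    rw [h0]
    exact Nat.zero_le _
  have hperm23 : ∀ b c a : Fin (borderSubrank T),
      unitTensor F (borderSubrank T) a b c = unitTensor F (borderSubrank T) b c a := by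
    intro b c a
    simp only [unitTensor]
    congr 1
    grind
  have hperm13 : ∀ a c b : Fin (borderSubrank T),
      unitTensor F (borderSubrank T) a b c = unitTensor F (borderSubrank T) a c b := by
    intro a c b
    simp only [unitTensor]
    congr 1
    grind
  intro i
  fin_cases i
  · refine le_maxrank_of_degeneration _ B C A (fun s b c a => S s a b c) (fun b c a => ?_) s hs
    rw [← hperm23, ← h a b c, Finset.sum_comm_cycle]
    refine Finset.sum_congr rfl fun i _ => Finset.sum_congr rfl fun j _ =>
      Finset.sum_congr rfl fun k _ => ?_
    rw [Matrix.of_apply]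
    ring
  · refine le_maxrank_of_degeneration _ A C B (fun s a c b => S s a b c) (fun a c b => ?_) s hs
    rw [← hperm13, ← h a b c]
    refine Finset.sum_congr rfl fun i _ => Finset.sum_comm.trans ?_
    refine Finset.sum_congr rfl fun j _ => Finset.sum_congr rfl fun k _ => ?_
    rw [Matrix.of_apply]
    ring
  · exact le_maxrank_of_degeneration _ A B C S h s hs

end Paper
end

section
/- Let F be a field and let T ∈ F^{n1} ⊗ F^{n2} ⊗ F^{n3} be an order-three tensor. Then the border subrank of the third Kronecker power satisfies Q̲(T^{⊠3}) ≥ (3/64) · SR(T)². -/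
open scoped BigOperators

namespace Paper

variable {F : Type*} [Field F]

open scoped Matrix
theorem exists_smith_factorization {R m n : Type*} [CommRing R] [IsDomain R]
    [IsPrincipalIdealRing R] [Fintype m] [DecidableEq m] [Fintype n] [DecidableEq n]
    (M : Matrix m n R) :
    ∃ (s : ℕ) (B : Matrix (Fin s) m R) (C : Matrix n (Fin s) R) (β : Matrix m (Fin s) R)
      (γ : Matrix (Fin s) n R),
      (B * M * C).det ≠ 0 ∧ β * B * M = M ∧ M * C * γ = M := by
  obtain ⟨s, bM, bN, f, a, snf⟩ :=
    Submodule.smithNormalForm (Pi.basisFun R m) (LinearMap.range M.mulVecLin)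
  have hc : ∀ l, ∃ c : n → R, M *ᵥ c = bN l := fun l => by
    obtain ⟨c, hc⟩ := (bN l).2
    exact ⟨c, by simpa using hc⟩
  choose c hc using hc
  have hrepr : ∀ w : n → R, ∃ g : Fin s → R, M *ᵥ w = ∑ l, g l • (bN l : m → R) := fun w => by
    refine ⟨fun l => bN.repr ⟨M *ᵥ w, w, rfl⟩ l, ?_⟩
    have h := congrArg Subtype.val (bN.sum_repr ⟨M *ᵥ w, w, rfl⟩)
    simp only [Submodule.coe_sum, Submodule.coe_smul] at h
    exact h.symm
  choose g hg using fun k => hrepr (Pi.single k 1)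
  let B : Matrix (Fin s) m R := Matrix.of fun l j => bM.repr (Pi.single j 1) (f l)
  let β : Matrix m (Fin s) R := Matrix.of fun j l => bM (f l) j
  let C : Matrix n (Fin s) R := Matrix.of fun k l => c l k
  let γ : Matrix (Fin s) n R := Matrix.of fun l k => g k l
  have hB : ∀ v : m → R, ∀ l, (B *ᵥ v) l = bM.repr v (f l) := fun v l => by
    conv_rhs => rw [pi_eq_sum_univ' v]
    simp [B, Matrix.mulVec, dotProduct, Finsupp.finsetSum_apply, mul_comm]
  have hMC : ∀ l, (M * C).col l = bN l := fun l => by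
    rw [← hc l]; rfl
  have ha : ∀ l, a l ≠ 0 := fun l h => by
    have := snf l
    rw [h, zero_smul] at this
    exact bN.ne_zero l (Subtype.ext this)
  refine ⟨s, B, C, β, γ, ?_, ?_, ?_⟩
  · have : B * M * C = Matrix.diagonal a := by
      ext l l'
      have h1 : (B * M * C) l l' = (B *ᵥ (M * C).col l') l := by
        rw [Matrix.mul_assoc]; rfl
      rw [h1, hMC, hB, snf]
      by_cases h : l = l'
      · subst h; simp
      · simp [h]
    rw [this, Matrix.det_diagonal]
    exact Finset.prod_ne_zero_iff.mpr fun l _ => ha l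
  · ext j k
    have h1 : (β * B * M) j k = (β *ᵥ (B *ᵥ M.col k)) j := by
      rw [Matrix.mul_assoc]; rfl
    have h2 : M.col k = ∑ l, g k l • (bN l : m → R) := by
      rw [← hg k]; simp
    have h3 : ∀ l, (B *ᵥ M.col k) l = g k l * a l := fun l => by
      rw [hB, h2]
      simp [snf, Finsupp.finsetSum_apply, Finsupp.single_apply]
    have h4 : M j k = M.col k j := rfl
    rw [h1, h4]
    simp only [Matrix.mulVec, dotProduct] at h3 ⊢
    simp only [h3]
    rw [h2]
    simp [snf, β, mul_comm, mul_left_comm, mul_assoc]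
  · ext j k
    have h1 : (M * C * γ) j k = ∑ l, (M * C).col l j * g k l := rfl
    have h2 : M j k = (∑ l, g k l • (bN l : m → R)) j := by
      rw [← hg k]; simp
    rw [h1, h2]
    simp only [hMC]
    simp [mul_comm]

/-- The linear combination of the 1-slices of `T` with power series coefficients `a`. -/
noncomputable def pencil {ι1 ι2 ι3 : Type*} [Fintype ι1] (T : ι1 → ι2 → ι3 → F)
    (a : ι1 → PowerSeries F) : Matrix ι2 ι3 (PowerSeries F) :=
  Matrix.of fun j k => ∑ i, a i * PowerSeries.C (T i j k)

/-- Some power series combination of the 1-slices of `T` has rank at least `s`. -/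
def PencilRankGE {ι1 ι2 ι3 : Type*} [Fintype ι1] [Fintype ι2] [Fintype ι3]
    (T : ι1 → ι2 → ι3 → F) (s : ℕ) : Prop :=
  ∃ (a : ι1 → PowerSeries F) (B : Matrix (Fin s) ι2 (PowerSeries F))
    (C : Matrix ι3 (Fin s) (PowerSeries F)), (B * pencil T a * C).det ≠ 0

theorem PencilRankGE.le_card {ι1 ι2 ι3 : Type*} [Fintype ι1] [Fintype ι2] [Fintype ι3]
    {T : ι1 → ι2 → ι3 → F} {s : ℕ} (h : PencilRankGE T s) : s ≤ Fintype.card ι2 := by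
  obtain ⟨a, B, C, h⟩ := h
  calc s = (B * pencil T a * C).rank := by rw [Matrix.rank_of_det_ne_zero h, Fintype.card_fin]
    _ ≤ B.rank := by rw [Matrix.mul_assoc]; exact Matrix.rank_mul_le_left _ _
    _ ≤ _ := Matrix.rank_le_card_width _

theorem PencilRankGE.of_reindex {ι1 ι2 ι3 κ : Type*} [Fintype ι1] [Fintype ι2] [Fintype ι3]
    [Fintype κ] [DecidableEq κ] {T : ι1 → ι2 → ι3 → F} {s : ℕ} (e : Fin s ≃ κ)
    (a : ι1 → PowerSeries F) (B : Matrix κ ι2 (PowerSeries F))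
    (C : Matrix ι3 κ (PowerSeries F)) (h : (B * pencil T a * C).det ≠ 0) :
    PencilRankGE T s := by
  refine ⟨a, B.submatrix e id, C.submatrix id e, ?_⟩
  rw [← Matrix.det_submatrix_equiv_self e] at h
  exact h

theorem exists_not_X_pow_dvd {p : PowerSeries F} (hp : p ≠ 0) : ∃ N : ℕ, ¬ PowerSeries.X ^ N ∣ p := by
  by_contra! h
  exact hp (PowerSeries.ext fun n => by
    simpa using PowerSeries.X_pow_dvd_iff.mp (h (n + 1)) n (Nat.lt_succ_self n))

theorem dvd_det_add_smul_sub_det {R κ : Type*} [CommRing R] [Fintype κ] [DecidableEq κ]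
    (t : R) (G H : Matrix κ κ R) : t ∣ (G + t • H).det - G.det := by
  rw [← Ideal.mem_span_singleton, ← Ideal.Quotient.mk_eq_mk_iff_sub_mem, RingHom.map_det,
    RingHom.map_det]
  congr 1
  ext i j
  have : Ideal.Quotient.mk (Ideal.span {t}) t = 0 :=
    Ideal.Quotient.eq_zero_iff_mem.mpr (Ideal.mem_span_singleton_self t)
  simp [this]

theorem PencilRankGE.succ {ι1 ι2 ι3 : Type*} [Fintype ι1] [DecidableEq ι1] [Fintype ι2]
    [Fintype ι3] {T : ι1 → ι2 → ι3 → F} {s : ℕ} (a : ι1 → PowerSeries F)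
    (B : Matrix (Fin s) ι2 (PowerSeries F)) (C : Matrix ι3 (Fin s) (PowerSeries F))
    (h : (B * pencil T a * C).det ≠ 0) (u : Matrix Unit ι2 (PowerSeries F))
    (w : Matrix ι3 Unit (PowerSeries F)) (hu : u * pencil T a = 0) (hw : pencil T a * w = 0)
    (i : ι1) (hi : (u * (Matrix.of (T i)).map PowerSeries.C * w).det ≠ 0) :
    PencilRankGE T (s + 1) := by
  set Ti : Matrix ι2 ι3 (PowerSeries F) := (Matrix.of (T i)).map PowerSeries.C with hTi
  obtain ⟨N, hN⟩ := exists_not_X_pow_dvd (mul_ne_zero h hi)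
  set t : PowerSeries F := PowerSeries.X ^ N with ht
  have ht0 : t ≠ 0 := pow_ne_zero _ PowerSeries.X_ne_zero
  have hpen : pencil T (a + Pi.single i t) = pencil T a + t • Ti := by
    ext1 j k
    simp [pencil, hTi, add_mul, Finset.sum_add_distrib, Pi.single_apply]
  refine PencilRankGE.of_reindex (κ := Fin s ⊕ Unit)
    (finSumFinEquiv.symm.trans (Equiv.sumCongr (Equiv.refl _) (Equiv.ofUnique _ _)))
    (a + Pi.single i t) (Matrix.fromRows B u) (Matrix.fromCols C w) ?_
  have key : Matrix.fromRows B u * pencil T (a + Pi.single i t) * Matrix.fromCols C w =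
      (Matrix.fromBlocks (B * pencil T a * C) (B * Ti * w) 0 (u * Ti * w) +
        t • Matrix.fromBlocks (B * Ti * C) 0 (u * Ti * C) 0) *
      Matrix.fromBlocks 1 0 0 (t • 1) := by
    rw [hpen, Matrix.fromRows_mul, Matrix.fromRows_mul_fromCols, Matrix.fromBlocks_smul,
      Matrix.fromBlocks_add, Matrix.fromBlocks_multiply]
    have hBw : B * pencil T a * w = 0 := by rw [Matrix.mul_assoc, hw, Matrix.mul_zero]
    simp [Matrix.mul_add, Matrix.add_mul, hu, hBw]
  rw [key, Matrix.det_mul, Matrix.det_fromBlocks_zero₁₂]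
  refine mul_ne_zero (fun h0 => hN ?_) (by simp [ht0])
  have := dvd_det_add_smul_sub_det t
    (Matrix.fromBlocks (B * pencil T a * C) (B * Ti * w) 0 (u * Ti * w))
    (Matrix.fromBlocks (B * Ti * C) 0 (u * Ti * C) 0)
  rwa [h0, Matrix.det_fromBlocks_zero₂₁, zero_sub, dvd_neg] at this

theorem exists_pencilRankGE_and_decomposition {ι1 ι2 ι3 : Type*} [Fintype ι1] [Fintype ι2]
    [Fintype ι3] (T : ι1 → ι2 → ι3 → F) :
    ∃ s, PencilRankGE T s ∧
      ∃ (β : ι2 → Fin s → F) (G : Fin s → ι1 → ι3 → F) (γ : ι3 → Fin s → F)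
        (H : Fin s → ι1 → ι2 → F),
        ∀ i j k, T i j k = ∑ l, β j l * G l i k + ∑ l, γ k l * H l i j := by
  classical
  have h0 : PencilRankGE T 0 := ⟨0, 0, 0, by simp⟩
  let s₀ := Nat.findGreatest (PencilRankGE T) (Fintype.card ι2)
  have hs₀ : PencilRankGE T s₀ := Nat.findGreatest_spec (Nat.zero_le _) h0
  have hmax : ∀ s, PencilRankGE T s → s ≤ s₀ := fun s hs => Nat.le_findGreatest hs.le_card hs
  obtain ⟨a, B₀, C₀, hdet₀⟩ := hs₀
  obtain ⟨s, B, C, β, γ, hdet, hβ, hγ⟩ := exists_smith_factorization (pencil T a)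
  have hs : s₀ ≤ s := by
    have : B₀ * pencil T a * C₀ = (B₀ * pencil T a * C) * (γ * C₀) := by
      conv_lhs => rw [← hγ]
      simp only [Matrix.mul_assoc]
    calc s₀ = (B₀ * pencil T a * C₀).rank := by
          rw [Matrix.rank_of_det_ne_zero hdet₀, Fintype.card_fin]
      _ ≤ (B₀ * pencil T a * C).rank := by rw [this]; exact Matrix.rank_mul_le_left _ _
      _ ≤ s := (Matrix.rank_le_card_width _).trans (Fintype.card_fin s).le
  have hu : (1 - β * B) * pencil T a = 0 := by rw [Matrix.sub_mul, hβ, Matrix.one_mul, sub_self]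
  have hw : pencil T a * (1 - C * γ) = 0 := by
    rw [Matrix.mul_sub, ← Matrix.mul_assoc, hγ, Matrix.mul_one, sub_self]
  have hzero : ∀ i, (1 - β * B) * (Matrix.of (T i)).map PowerSeries.C * (1 - C * γ) = 0 := by
    intro i
    ext1 j k
    by_contra hne
    have hsucc := PencilRankGE.succ a B C hdet ((1 - β * B).submatrix (fun _ : Unit => j) id)
      ((1 - C * γ).submatrix id (fun _ : Unit => k))
      (by ext1 x k'; exact congrFun (congrFun hu j) k')
      (by ext1 j' x; exact congrFun (congrFun hw j') k) i (by
        rw [Matrix.det_unique]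
        exact hne)
    have := hmax _ hsucc
    omega
  refine ⟨s, ⟨a, B, C, hdet⟩, β.map PowerSeries.constantCoeff,
    fun l i k => (B.map PowerSeries.constantCoeff * Matrix.of (T i)) l k,
    fun k l => PowerSeries.constantCoeff (γ l k),
    fun l i j => ((1 - β * B).map PowerSeries.constantCoeff * Matrix.of (T i) *
      C.map PowerSeries.constantCoeff) j l, fun i j k => ?_⟩
  have hT : (Matrix.of (T i)).map PowerSeries.C =
      β * (B * (Matrix.of (T i)).map PowerSeries.C) +
        (1 - β * B) * (Matrix.of (T i)).map PowerSeries.C * C * γ := by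
    have h := hzero i
    rw [Matrix.mul_sub, sub_eq_zero, Matrix.mul_one] at h
    rw [Matrix.mul_assoc _ C γ, ← h, Matrix.sub_mul, Matrix.one_mul, Matrix.mul_assoc]
    abel
  have hT' := congrArg (fun M => M.map PowerSeries.constantCoeff) hT
  have hid : ((Matrix.of (T i)).map PowerSeries.C).map PowerSeries.constantCoeff =
      Matrix.of (T i) := by
    ext; simp
  simp only [Matrix.map_add _ (map_add PowerSeries.constantCoeff), Matrix.map_mul, hid] at hT'
  have hjk := congrFun (congrFun hT' j) k
  rw [Matrix.add_apply] at hjk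
  refine hjk.trans (congrArg₂ (· + ·) rfl ?_)
  rw [Matrix.mul_apply]
  exact Finset.sum_congr rfl fun l _ => mul_comm _ _

theorem rank_vecMulVec_eq_one {m n : Type*} [Fintype m] [Fintype n] {u : m → F} {v : n → F}
    (h : Matrix.vecMulVec u v ≠ 0) : (Matrix.vecMulVec u v).rank = 1 := by
  refine le_antisymm (Matrix.rank_vecMulVec_le u v) (Nat.one_le_iff_ne_zero.mpr fun h0 => h ?_)
  rw [Matrix.rank, Submodule.finrank_eq_zero, LinearMap.range_eq_bot] at h0
  classical
  exact Matrix.toLin'.injective (by rw [map_zero]; exact h0)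

/-- `f` is the product of a vector in one leg and a matrix in the two other legs. -/
def IsSliceProduct {ι1 ι2 ι3 : Type*} (f : ι1 → ι2 → ι3 → F) : Prop :=
  (∃ (u : ι1 → F) (g : ι2 → ι3 → F), f = fun i j k => u i * g j k) ∨
  (∃ (u : ι2 → F) (g : ι1 → ι3 → F), f = fun i j k => u j * g i k) ∨
  (∃ (u : ι3 → F) (g : ι1 → ι2 → F), f = fun i j k => u k * g i j)

theorem IsSliceProduct.sliceRankOne {ι1 ι2 ι3 : Type*} [Fintype ι1] [Fintype ι2] [Fintype ι3]
    {f : ι1 → ι2 → ι3 → F} (h : IsSliceProduct f) (hf : f ≠ 0) : SliceRankOne f := by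
  rcases h with ⟨u, g, rfl⟩ | ⟨u, g, rfl⟩ | ⟨u, g, rfl⟩
  · have h1 : flattening1 (fun i j k => u i * g j k) = Matrix.vecMulVec u fun p => g p.1 p.2 := rfl
    refine Or.inl (h1 ▸ rank_vecMulVec_eq_one fun h0 => hf ?_)
    ext i j k
    exact congrFun (congrFun h0 i) (j, k)
  · have h1 : flattening2 (fun i j k => u j * g i k) = Matrix.vecMulVec u fun p => g p.1 p.2 := rfl
    refine Or.inr (Or.inl (h1 ▸ rank_vecMulVec_eq_one fun h0 => hf ?_))
    ext i j k
    exact congrFun (congrFun h0 j) (i, k)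
  · have h1 : flattening3 (fun i j k => u k * g i j) = Matrix.vecMulVec u fun p => g p.1 p.2 := rfl
    refine Or.inr (Or.inr (h1 ▸ rank_vecMulVec_eq_one fun h0 => hf ?_))
    ext i j k
    exact congrFun (congrFun h0 k) (i, j)

theorem sliceRank_le_card {ι1 ι2 ι3 κ : Type*} [Fintype ι1] [Fintype ι2] [Fintype ι3] [Fintype κ]
    {T : ι1 → ι2 → ι3 → F} (f : κ → ι1 → ι2 → ι3 → F) (hf : ∀ t, IsSliceProduct (f t))
    (hT : T = ∑ t, f t) : sliceRank T ≤ Fintype.card κ := by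
  classical
  let S := Finset.univ.filter fun t => f t ≠ 0
  have hS : S.card ≤ Fintype.card κ := Finset.card_le_univ S
  refine le_trans (Nat.sInf_le ?_) hS
  refine ⟨fun t => f (S.equivFin.symm t), fun t => ?_, ?_⟩
  · exact (hf _).sliceRankOne (Finset.mem_filter.mp (S.equivFin.symm t).2).2
  · rw [hT, Equiv.sum_comp S.equivFin.symm (fun t => f t), Finset.sum_coe_sort S f,
      Finset.sum_filter_ne_zero]

theorem exists_pencilRankGE_fst {ι1 ι2 ι3 : Type*} [Fintype ι1] [Fintype ι2] [Fintype ι3]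
    (T : ι1 → ι2 → ι3 → F) : ∃ s, PencilRankGE T s ∧ sliceRank T ≤ 2 * s := by
  obtain ⟨s, hs, β, G, γ, H, h⟩ := exists_pencilRankGE_and_decomposition T
  refine ⟨s, hs, (sliceRank_le_card (κ := Fin s ⊕ Fin s)
    (Sum.elim (fun l i j k => β j l * G l i k) fun l i j k => γ k l * H l i j) ?_ ?_).trans
      (by simp [two_mul])⟩
  · rintro (l | l)
    · exact Or.inr (Or.inl ⟨fun j => β j l, G l, rfl⟩)
    · exact Or.inr (Or.inr ⟨fun k => γ k l, H l, rfl⟩)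
  · ext i j k
    simp [h, Finset.sum_apply]

theorem exists_pencilRankGE_snd {ι1 ι2 ι3 : Type*} [Fintype ι1] [Fintype ι2] [Fintype ι3]
    (T : ι1 → ι2 → ι3 → F) :
    ∃ s, PencilRankGE (fun j i k => T i j k) s ∧ sliceRank T ≤ 2 * s := by
  obtain ⟨s, hs, β, G, γ, H, h⟩ :=
    exists_pencilRankGE_and_decomposition fun j i k => T i j k
  refine ⟨s, hs, (sliceRank_le_card (κ := Fin s ⊕ Fin s)
    (Sum.elim (fun l i j k => β i l * G l j k) fun l i j k => γ k l * H l j i) ?_ ?_).trans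
      (by simp [two_mul])⟩
  · rintro (l | l)
    · exact Or.inl ⟨fun i => β i l, G l, rfl⟩
    · exact Or.inr (Or.inr ⟨fun k => γ k l, fun i j => H l j i, rfl⟩)
  · ext i j k
    simp [h j i k, Finset.sum_apply]

theorem exists_pencilRankGE_trd {ι1 ι2 ι3 : Type*} [Fintype ι1] [Fintype ι2] [Fintype ι3]
    (T : ι1 → ι2 → ι3 → F) :
    ∃ s, PencilRankGE (fun k i j => T i j k) s ∧ sliceRank T ≤ 2 * s := by
  obtain ⟨s, hs, β, G, γ, H, h⟩ :=
    exists_pencilRankGE_and_decomposition fun k i j => T i j k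
  refine ⟨s, hs, (sliceRank_le_card (κ := Fin s ⊕ Fin s)
    (Sum.elim (fun l i j k => β i l * G l k j) fun l i j k => γ j l * H l k i) ?_ ?_).trans
      (by simp [two_mul])⟩
  · rintro (l | l)
    · exact Or.inl ⟨fun i => β i l, fun j k => G l k j, rfl⟩
    · exact Or.inr (Or.inl ⟨fun j => γ j l, fun i k => H l k i, rfl⟩)
  · ext i j k
    simp [h k i j, Finset.sum_apply]

theorem PencilRankGE.exists_diagonal {ι1 ι2 ι3 : Type*} [Fintype ι1] [Fintype ι2] [Fintype ι3]
    {T : ι1 → ι2 → ι3 → F} {s : ℕ} (h : PencilRankGE T s) :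
    ∃ (d : ℕ) (a : ι1 → PowerSeries F) (B : Fin s → ι2 → PowerSeries F)
      (C : Fin s → ι3 → PowerSeries F), ∀ p q,
        ∑ i, ∑ j, ∑ k, a i * B p j * C q k * PowerSeries.C (T i j k) =
          if p = q then (PowerSeries.X ^ d : PowerSeries F) else 0 := by
  obtain ⟨a, B, C, h⟩ := h
  set N := B * pencil T a * C with hN
  set v : (PowerSeries F)ˣ := PowerSeries.Unit_of_divided_by_X_pow_order N.det with hv
  have hdet : N.det = (PowerSeries.X : PowerSeries F) ^ N.det.order.toNat * v.val := by
    rw [hv, PowerSeries.Unit_of_divided_by_X_pow_order_nonzero h,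
      PowerSeries.X_pow_order_mul_divXPowOrder]
  let B' : Matrix (Fin s) ι2 (PowerSeries F) := (↑v⁻¹ : PowerSeries F) •
    (N.adjugate * B)
  refine ⟨N.det.order.toNat, a, B', fun q k => C k q, fun p q => ?_⟩
  have key : B' * pencil T a * C =
      (PowerSeries.X ^ N.det.order.toNat : PowerSeries F) • (1 : Matrix (Fin s) (Fin s) _) := by
    simp only [B', Matrix.smul_mul]
    rw [Matrix.mul_assoc N.adjugate, Matrix.mul_assoc N.adjugate, ← hN, Matrix.adjugate_mul,
      smul_smul]
    conv_lhs => rw [hdet]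
    rw [mul_left_comm, Units.inv_mul, mul_one]
  have hpq := congrFun (congrFun key p) q
  rw [Matrix.smul_apply, Matrix.one_apply, smul_eq_mul, mul_ite, mul_one, mul_zero] at hpq
  rw [← hpq, Matrix.mul_apply]
  simp only [Matrix.mul_apply, pencil, Matrix.of_apply, Finset.sum_mul, Finset.mul_sum]
  rw [Finset.sum_comm]
  simp only [Finset.sum_comm (s := (Finset.univ : Finset ι1))]
  rw [Finset.sum_comm]
  refine Finset.sum_congr rfl fun k _ => Finset.sum_congr rfl fun j _ =>
    Finset.sum_congr rfl fun i _ => by ring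

theorem bddAbove_degenerations {ι1 ι2 ι3 : Type*} [Fintype ι1] [Fintype ι2] [Fintype ι3]
    (T : ι1 → ι2 → ι3 → F) :
    BddAbove {r : ℕ |
      ∃ (A : Fin r → ι1 → LaurentPolynomial F) (B : Fin r → ι2 → LaurentPolynomial F)
        (C : Fin r → ι3 → LaurentPolynomial F) (t : ℕ)
        (S : Fin t → (Fin r → Fin r → Fin r → F)),
        ∀ a b c,
          (∑ i, ∑ j, ∑ k, A a i * B b j * C c k * LaurentPolynomial.C (T i j k)) =
            LaurentPolynomial.C (unitTensor F r a b c) +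
              ∑ s : Fin t, LaurentPolynomial.T (((s : ℕ) : ℤ) + 1) *
                LaurentPolynomial.C (S s a b c)} := by
  refine ⟨Fintype.card ι1, ?_⟩
  rintro r ⟨A, B, C, t, S, h⟩
  let P : Matrix (Fin r) (Fin r) (Polynomial F) := Matrix.of fun a b =>
    ∑ c, (Polynomial.C (unitTensor F r a b c) +
      ∑ s : Fin t, Polynomial.X ^ ((s : ℕ) + 1) * Polynomial.C (S s a b c))
  have hPdet : P.det ≠ 0 := by
    intro h0
    have h1 := congrArg (Polynomial.evalRingHom (0 : F)) h0
    rw [RingHom.map_det] at h1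
    have h2 : (Polynomial.evalRingHom (0 : F)).mapMatrix P = 1 := by
      ext a b
      by_cases hab : a = b
      · subst hab
        simp [P, Polynomial.eval_finsetSum, unitTensor, apply_ite (Polynomial.eval (0 : F))]
      · simp [P, Polynomial.eval_finsetSum, unitTensor, hab]
    rw [h2] at h1
    simp at h1
  have hdet : (P.map Polynomial.toLaurent).det ≠ 0 := by
    rw [← RingHom.mapMatrix_apply, ← RingHom.map_det]
    exact Polynomial.toLaurent_ne_zero.mpr hPdet
  have hfac : P.map Polynomial.toLaurent =
      (Matrix.of A : Matrix (Fin r) ι1 (LaurentPolynomial F)) *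
        (Matrix.of fun i b => ∑ c, ∑ j, ∑ k, B b j * C c k * LaurentPolynomial.C (T i j k)) := by
    ext1 a b
    have h1 : (P.map Polynomial.toLaurent) a b =
        ∑ c, ∑ i, ∑ j, ∑ k, A a i * B b j * C c k * LaurentPolynomial.C (T i j k) := by
      simp only [h]
      simp only [P, Matrix.map_apply, Matrix.of_apply, map_sum, map_add, map_mul,
        Polynomial.toLaurent_C, Polynomial.toLaurent_X_pow, Nat.cast_add, Nat.cast_one]
    rw [h1, Finset.sum_comm]
    simp only [Matrix.mul_apply, Matrix.of_apply, Finset.mul_sum, mul_assoc]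
  calc r = (P.map Polynomial.toLaurent).rank := by
        rw [Matrix.rank_of_det_ne_zero hdet, Fintype.card_fin]
    _ ≤ _ := by rw [hfac]; exact Matrix.rank_mul_le_left _ _
    _ ≤ _ := Matrix.rank_le_card_width _

theorem card_le_borderSubrank {ι1 ι2 ι3 L : Type*} [Fintype ι1] [Fintype ι2] [Fintype ι3]
    [Fintype L] [DecidableEq L] {T : ι1 → ι2 → ι3 → F} (A : L → ι1 → PowerSeries F)
    (B : L → ι2 → PowerSeries F) (C : L → ι3 → PowerSeries F) (q : ℕ)
    (h : ∀ a b c, (PowerSeries.X ^ (q + 1) : PowerSeries F) ∣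
      (∑ i, ∑ j, ∑ k, A a i * B b j * C c k * PowerSeries.C (T i j k)) -
        if a = b ∧ b = c then PowerSeries.X ^ q else 0) :
    Fintype.card L ≤ borderSubrank T := by
  let e := (Fintype.equivFin L).symm
  let tr : PowerSeries F → Polynomial F := PowerSeries.trunc (q + 1)
  let π := Ideal.Quotient.mk (Ideal.span {(PowerSeries.X ^ (q + 1) : PowerSeries F)})
  have hπ : ∀ x y : PowerSeries F, π x = π y ↔ PowerSeries.X ^ (q + 1) ∣ x - y := fun x y => by
    rw [← Ideal.mem_span_singleton]; exact Ideal.Quotient.mk_eq_mk_iff_sub_mem _ _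
  have hπ0 : ∀ x : PowerSeries F, PowerSeries.X ^ (q + 1) ∣ x ↔ π x = 0 := fun x => by
    rw [← map_zero π, hπ, sub_zero]
  let ψ : Polynomial F →+* _ := π.comp Polynomial.coeToPowerSeries.ringHom
  have hψ : ∀ p : Polynomial F, π (p : PowerSeries F) = ψ p := fun _ => rfl
  have htr : ∀ p, ψ (tr p) = π p := fun p => by
    rw [← hψ, hπ, PowerSeries.X_pow_dvd_iff]
    intro m hm
    simp [tr, PowerSeries.coeff_trunc, hm]
  have hψC : ∀ x : F, ψ (Polynomial.C x) = π (PowerSeries.C x) := fun x => by simp [ψ]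
  have hψX : ψ Polynomial.X = π PowerSeries.X := by simp [ψ]
  have hex : ∀ a b c, ∃ Q : Polynomial F,
      ∑ i, ∑ j, ∑ k, tr (A (e a) i) * tr (B (e b) j) * tr (C (e c) k) * Polynomial.C (T i j k) =
        Polynomial.X ^ q * Polynomial.C (unitTensor F _ a b c) + Polynomial.X ^ (q + 1) * Q := by
    intro a b c
    suffices hd : (PowerSeries.X ^ (q + 1) : PowerSeries F) ∣
        ((∑ i, ∑ j, ∑ k, tr (A (e a) i) * tr (B (e b) j) * tr (C (e c) k) *
          Polynomial.C (T i j k) -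
          Polynomial.X ^ q * Polynomial.C (unitTensor F _ a b c) : Polynomial F) :
            PowerSeries F) by
      have hd' : (Polynomial.X ^ (q + 1) : Polynomial F) ∣
          ∑ i, ∑ j, ∑ k, tr (A (e a) i) * tr (B (e b) j) * tr (C (e c) k) *
            Polynomial.C (T i j k) - Polynomial.X ^ q * Polynomial.C (unitTensor F _ a b c) := by
        rw [Polynomial.X_pow_dvd_iff]
        intro d hd1
        simpa only [Polynomial.coeff_coe] using PowerSeries.X_pow_dvd_iff.mp hd d hd1
      obtain ⟨Q, hQ⟩ := hd'
      exact ⟨Q, by rw [← hQ]; ring⟩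
    have h1 := h (e a) (e b) (e c)
    rw [hπ0] at h1 ⊢
    rw [hψ]
    have hunit : ψ (Polynomial.X ^ q * Polynomial.C (unitTensor F _ a b c)) =
        π (if e a = e b ∧ e b = e c then PowerSeries.X ^ q else 0) := by
      rw [map_mul, map_pow, hψX, hψC, ← map_pow, ← map_mul]
      simp [unitTensor]
    rw [map_sub, hunit]
    simpa only [map_sub, map_sum, map_mul, hψC, htr] using h1
  choose Q hQ using hex
  let t := (Finset.univ.sup fun a => Finset.univ.sup fun b => Finset.univ.sup fun c =>
    (Q a b c).natDegree) + 1
  have ht : ∀ a b c, (Q a b c).natDegree < t := fun a b c => by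
    refine Nat.lt_succ_of_le ?_
    refine le_trans ?_ (Finset.le_sup (Finset.mem_univ a))
    refine le_trans ?_ (Finset.le_sup (Finset.mem_univ b))
    exact Finset.le_sup (f := fun c => (Q a b c).natDegree) (Finset.mem_univ c)
  refine le_csSup (bddAbove_degenerations T)
    ⟨fun a i => Polynomial.toLaurent (tr (A (e a) i)) * LaurentPolynomial.T (-q),
      fun b j => Polynomial.toLaurent (tr (B (e b) j)),
      fun c k => Polynomial.toLaurent (tr (C (e c) k)), t, fun s a b c => (Q a b c).coeff s,
      fun a b c => ?_⟩
  have h1 := congrArg (fun p => Polynomial.toLaurent p * LaurentPolynomial.T (-q)) (hQ a b c)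
  have h2 : (Q a b c) = ∑ s : Fin t, Polynomial.X ^ (s : ℕ) * Polynomial.C ((Q a b c).coeff s) := by
    conv_lhs => rw [Polynomial.as_sum_range' _ t (ht a b c), Finset.sum_range]
    exact Finset.sum_congr rfl fun s _ => by
      rw [Polynomial.X_pow_mul_C, Polynomial.C_mul_X_pow_eq_monomial]
  rw [h2] at h1
  simp only [map_sum, map_mul, map_add, Polynomial.toLaurent_C, Polynomial.toLaurent_X_pow,
    Finset.sum_mul, add_mul, Finset.mul_sum] at h1
  refine Eq.trans ?_ (h1.trans ?_)
  · refine Finset.sum_congr rfl fun i _ => Finset.sum_congr rfl fun j _ =>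
      Finset.sum_congr rfl fun k _ => by ring
  · congr 1
    · rw [mul_right_comm, ← LaurentPolynomial.T_add]
      simp
    · refine Finset.sum_congr rfl fun s _ => ?_
      rw [← mul_assoc, mul_right_comm, ← LaurentPolynomial.T_add, ← LaurentPolynomial.T_add]
      congr 2
      push_cast; ring

theorem kronPow_three_restriction {ι1 ι2 ι3 : Type*} [Fintype ι1] [Fintype ι2] [Fintype ι3]
    (T : ι1 → ι2 → ι3 → F) (α : Fin 3 → ι1 → PowerSeries F) (β : Fin 3 → ι2 → PowerSeries F)
    (γ : Fin 3 → ι3 → PowerSeries F) :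
    ∑ x, ∑ y, ∑ z, (∏ s, α s (x s)) * (∏ s, β s (y s)) * (∏ s, γ s (z s)) *
        PowerSeries.C (kronPow T 3 x y z) =
      ∏ s, ∑ i, ∑ j, ∑ k, α s i * β s j * γ s k * PowerSeries.C (T i j k) := by
  classical
  simp only [Finset.prod_univ_sum, Fintype.piFinset_univ, kronPow, map_prod,
    Finset.prod_mul_distrib]

theorem PencilRankGE.exists_diagonal_of_le {ι1 ι2 ι3 : Type*} [Fintype ι1] [Fintype ι2]
    [Fintype ι3] {T : ι1 → ι2 → ι3 → F} {m s : ℕ} (h : PencilRankGE T s) (hm : m ≤ s) :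
    ∃ (d : ℕ) (a : ι1 → PowerSeries F) (B : Fin m → ι2 → PowerSeries F)
      (C : Fin m → ι3 → PowerSeries F), ∀ p q,
        ∑ i, ∑ j, ∑ k, a i * B p j * C q k * PowerSeries.C (T i j k) =
          if p = q then (PowerSeries.X ^ d : PowerSeries F) else 0 := by
  obtain ⟨d, a, B, C, h⟩ := h.exists_diagonal
  refine ⟨d, a, fun p => B (Fin.castLE hm p), fun p => C (Fin.castLE hm p), fun p q => ?_⟩
  rw [h]
  simp

/-- The exponents of the monomial degeneration of the matrix multiplication tensor. -/
def weight (c i j : ℕ) : ℕ := i * i + 2 * i * j + 2 * c * (c - i)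

theorem weight_sum {c i j k : ℕ} (hi : i ≤ c) (hj : j ≤ c) (hk : k ≤ c) :
    ((weight c i j + weight c j k + weight c k i : ℕ) : ℤ) =
      5 * c * c + ((i : ℤ) + j + k - c) ^ 2 := by
  simp only [weight]
  push_cast [Nat.cast_sub hi, Nat.cast_sub hj, Nat.cast_sub hk]
  ring

theorem weight_sum_of_eq {c i j k : ℕ} (h : i + j + k = c) :
    weight c i j + weight c j k + weight c k i = 5 * c * c := by
  have h1 := weight_sum (c := c) (i := i) (j := j) (k := k) (by omega) (by omega) (by omega)
  have h2 : (i : ℤ) + j + k - c = 0 := by omega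
  rw [h2] at h1
  zify at h1 ⊢
  linarith

theorem weight_sum_of_ne {c i j k : ℕ} (hi : i ≤ c) (hj : j ≤ c) (hk : k ≤ c)
    (h : i + j + k ≠ c) : 5 * c * c + 1 ≤ weight c i j + weight c j k + weight c k i := by
  have h1 := weight_sum hi hj hk
  have h2 : 0 < ((i : ℤ) + j + k - c) ^ 2 := by
    have : (i : ℤ) + j + k - c ≠ 0 := by omega
    positivity
  zify at h1 ⊢
  linarith

theorem mul_succ_le_two_mul_borderSubrank {ι1 ι2 ι3 : Type*} [Fintype ι1] [Fintype ι2]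
    [Fintype ι3] {T : ι1 → ι2 → ι3 → F} {m s₁ s₂ s₃ : ℕ} (h₁ : PencilRankGE T s₁)
    (h₂ : PencilRankGE (fun j i k => T i j k) s₂) (h₃ : PencilRankGE (fun k i j => T i j k) s₃)
    (hm₁ : m ≤ s₁) (hm₂ : m ≤ s₂) (hm₃ : m ≤ s₃) :
    m * (m + 1) ≤ 2 * borderSubrank (kronPow T 3) := by
  obtain ⟨d₁, a₁, B₁, C₁, h₁⟩ := h₁.exists_diagonal_of_le hm₁
  obtain ⟨d₂, a₂, B₂, C₂, h₂⟩ := h₂.exists_diagonal_of_le hm₂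
  obtain ⟨d₃, a₃, B₃, C₃, h₃⟩ := h₃.exists_diagonal_of_le hm₃
  let L := Σ i : Fin m, Fin (m - i)
  let I : L → Fin m := fun l => l.1
  let J : L → Fin m := fun l => ⟨l.2, by omega⟩
  let K : L → Fin m := fun l => ⟨m - 1 - l.1 - l.2, by omega⟩
  have hsum : ∀ l, (I l : ℕ) + J l + K l = m - 1 := fun l => by
    simp only [I, J, K]; omega
  have hext : ∀ l l', I l = I l' → J l = J l' → l = l' := by
    rintro ⟨i, j⟩ ⟨i', j'⟩ (hi : i = i') hj
    subst hi
    have : j = j' := Fin.ext (by simpa [J] using hj)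
    rw [this]
  have hcard : 2 * Fintype.card L = m * (m + 1) := by
    simp only [L, Fintype.card_sigma, Fintype.card_fin]
    rw [Fin.sum_univ_eq_sum_range (fun i => m - i)]
    have : ∀ n, 2 * ∑ i ∈ Finset.range n, (n - i) = n * (n + 1) := fun n => by
      induction n with
      | zero => rfl
      | succ n ih =>
        rw [Finset.sum_range_succ']
        simp only [Nat.add_sub_add_right, Nat.sub_zero, mul_add, ih]
        ring
    exact this m
  rw [← hcard]
  refine Nat.mul_le_mul_left 2 (card_le_borderSubrank
    (fun l x => PowerSeries.X ^ weight (m - 1) (I l) (J l) *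
      ∏ s, (![a₁, B₂ (I l), B₃ (J l)] : Fin 3 → _) s (x s))
    (fun l x => PowerSeries.X ^ weight (m - 1) (J l) (K l) *
      ∏ s, (![B₁ (K l), a₂, C₃ (J l)] : Fin 3 → _) s (x s))
    (fun l x => PowerSeries.X ^ weight (m - 1) (K l) (I l) *
      ∏ s, (![C₁ (K l), C₂ (I l), a₃] : Fin 3 → _) s (x s))
    (d₁ + d₂ + d₃ + 5 * (m - 1) * (m - 1)) fun u v w => ?_)
  have h₂' : ∀ p q, ∑ i, ∑ j, ∑ k, B₂ p i * a₂ j * C₂ q k * PowerSeries.C (T i j k) =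
      if p = q then (PowerSeries.X ^ d₂ : PowerSeries F) else 0 := fun p q => by
    rw [← h₂, Finset.sum_comm]
    simp only [mul_comm (B₂ p _)]
  have h₃' : ∀ p q, ∑ i, ∑ j, ∑ k, B₃ p i * C₃ q j * a₃ k * PowerSeries.C (T i j k) =
      if p = q then (PowerSeries.X ^ d₃ : PowerSeries F) else 0 := fun p q => by
    rw [← h₃, Finset.sum_comm_cycle]
    simp only [mul_comm _ (a₃ _), mul_assoc]
  have hval : ∑ x, ∑ y, ∑ z,
      (PowerSeries.X ^ weight (m - 1) (I u) (J u) *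
        ∏ s, (![a₁, B₂ (I u), B₃ (J u)] : Fin 3 → _) s (x s)) *
      (PowerSeries.X ^ weight (m - 1) (J v) (K v) *
        ∏ s, (![B₁ (K v), a₂, C₃ (J v)] : Fin 3 → _) s (y s)) *
      (PowerSeries.X ^ weight (m - 1) (K w) (I w) *
        ∏ s, (![C₁ (K w), C₂ (I w), a₃] : Fin 3 → _) s (z s)) *
      PowerSeries.C (kronPow T 3 x y z) =
      PowerSeries.X ^ (weight (m - 1) (I u) (J u) + weight (m - 1) (J v) (K v) +
        weight (m - 1) (K w) (I w)) *
      ((if K v = K w then (PowerSeries.X ^ d₁ : PowerSeries F) else 0) *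
        (if I u = I w then (PowerSeries.X ^ d₂ : PowerSeries F) else 0) *
        (if J u = J v then (PowerSeries.X ^ d₃ : PowerSeries F) else 0)) := by
    rw [← h₁, ← h₂', ← h₃']
    have h := kronPow_three_restriction T ![a₁, B₂ (I u), B₃ (J u)] ![B₁ (K v), a₂, C₃ (J v)]
      ![C₁ (K w), C₂ (I w), a₃]
    rw [Fin.prod_univ_three (fun s => ∑ i, ∑ j, ∑ k, _)] at h
    refine Eq.trans ?_ (congrArg _ h)
    simp only [Finset.mul_sum]
    refine Finset.sum_congr rfl fun x _ => Finset.sum_congr rfl fun y _ =>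
      Finset.sum_congr rfl fun z _ => ?_
    rw [pow_add, pow_add]
    ring
  rw [hval]
  by_cases hK : K v = K w
  swap
  · have : ¬ (u = v ∧ v = w) := fun h => hK (by rw [h.2])
    simp [hK, this]
  by_cases hI : I u = I w
  swap
  · have : ¬ (u = v ∧ v = w) := fun h => hI (by rw [h.1, h.2])
    simp [hI, this]
  by_cases hJ : J u = J v
  swap
  · have : ¬ (u = v ∧ v = w) := fun h => hJ (by rw [h.1])
    simp [hJ, this]
  simp only [hK, hI, hJ, if_true, ← pow_add]
  have hu := hsum u
  have hv := hsum v
  have hw := hsum w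
  rw [hI, hJ] at hu
  rw [hK] at hv
  by_cases hs : (I w : ℕ) + J v + K w = m - 1
  · have hIv : I v = I w := Fin.ext (by omega)
    have hJv : J v = J w := Fin.ext (by omega)
    have huv : u = v := hext _ _ (hI.trans hIv.symm) hJ
    have hvw : v = w := hext _ _ hIv hJv
    rw [if_pos ⟨huv, hvw⟩, weight_sum_of_eq hs,
      add_comm (d₁ + d₂ + d₃), sub_self]
    exact dvd_zero _
  · have hne : ¬ (u = v ∧ v = w) := by
      rintro ⟨-, rfl⟩
      exact hs hw
    rw [if_neg hne, sub_zero]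
    have := weight_sum_of_ne (c := m - 1) (by omega) (by omega) (by omega) hs
    exact pow_dvd_pow _ (by omega)

/-- The border subrank of the third Kronecker power is at least
`(3/64) · SR(T)²`. -/
theorem borderSubrank_cube_ge_sliceRank_sq (F : Type*) [Field F] (n1 n2 n3 : ℕ)
    (T : Fin n1 → Fin n2 → Fin n3 → F) :
    (3 / 64 : ℝ) * (sliceRank T : ℝ) ^ 2 ≤ (borderSubrank (kronPow T 3) : ℝ) := by
  obtain ⟨s₁, h₁, hs₁⟩ := exists_pencilRankGE_fst T
  obtain ⟨s₂, h₂, hs₂⟩ := exists_pencilRankGE_snd T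
  obtain ⟨s₃, h₃, hs₃⟩ := exists_pencilRankGE_trd T
  set m := min s₁ (min s₂ s₃) with hm
  have h := mul_succ_le_two_mul_borderSubrank (m := m) h₁ h₂ h₃ (by omega) (by omega) (by omega)
  have hsr : sliceRank T ≤ 2 * m := by omega
  have h' : (m : ℝ) * (m + 1) ≤ 2 * borderSubrank (kronPow T 3) := by exact_mod_cast h
  have hsr' : (sliceRank T : ℝ) ≤ 2 * m := by exact_mod_cast hsr
  have hm0 : (0 : ℝ) ≤ m := Nat.cast_nonneg m
  have hsq : (sliceRank T : ℝ) ^ 2 ≤ (2 * m) ^ 2 := by gcongr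
  nlinarith
end Paper
end
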